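/- arXiv:1606.03944 — 2 statements merged into one kernel-verified Lean document; each statement's English description precedes it below -/
import Mathlib

section
/- There exists a universal constant C > 0 such that the following holds. Let j ≥ 1 be an integer, η ∈ (0,1), and let Γ : ℝ → ℝ be continuous with ‖Γ‖ := (∫_ℝ Γ(w)²·cosh(w)^{2η} dw)^{1/2} < ∞. If Ω : ℝ → ℝ is a bounded C² function satisfying Ω''(v) − j²·Ω(v) = Γ(v) for all v, then |Ω(v)| ≤ C·(‖Γ‖/(2j))·( (2(j+η))^{-1/2} + (2(j−η))^{-1/2} )·cosh(v)^{-η} for all v ∈ ℝ. -/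
open MeasureTheory intervalIntegral in
theorem hmd_integral_bound (q : ℝ → ℝ) (hq0 : ∀ w, 0 ≤ q w) (hi : Integrable q)
    (a b : ℝ) (hab : a ≤ b) : ∫ w in a..b, q w ≤ ∫ w, q w := by
  rw [intervalIntegral.integral_of_le hab]
  exact setIntegral_le_integral hi (Filter.Eventually.of_forall hq0)

theorem hmd_exp_bound (a T : ℝ) (ha : 0 < a) :
    ∫ s in (0:ℝ)..T, Real.exp (-(2 * a) * s) ≤ 1 / (2 * a) := by
  have h : ∀ s ∈ Set.uIcc 0 T,
      HasDerivAt (fun s => -(1 / (2 * a)) * Real.exp (-(2 * a) * s)) (Real.exp (-(2 * a) * s)) s := by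
    intro s _
    have h1 : HasDerivAt (fun s : ℝ => -(2 * a) * s) (-(2 * a)) s := by
      simpa using (hasDerivAt_id s).const_mul (-(2 * a))
    refine (h1.exp.const_mul (-(1 / (2 * a)))).congr_deriv ?_
    have h2 : 1 / (2 * a) * (2 * a) = 1 := one_div_mul_cancel (by positivity)
    linear_combination Real.exp (-(2 * a) * s) * h2
  rw [intervalIntegral.integral_eq_sub_of_hasDerivAt h
    ((by fun_prop : Continuous fun s : ℝ => Real.exp (-(2 * a) * s)).intervalIntegrable _ _)]
  have : 0 < 1 / (2 * a) * Real.exp (-(2 * a) * T) := by positivity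
  simp only [mul_zero, Real.exp_zero]
  linarith

theorem hmd_cosh_le (v w s : ℝ) (h : |v - w| ≤ s) : Real.cosh v ≤ Real.cosh w * Real.exp s := by
  obtain ⟨h1, h2⟩ := abs_le.1 h
  have e1 : Real.exp v ≤ Real.exp w * Real.exp s := by
    rw [← Real.exp_add]; exact Real.exp_le_exp.2 (by linarith)
  have e2 : Real.exp (-v) ≤ Real.exp (-w) * Real.exp s := by
    rw [← Real.exp_add]; exact Real.exp_le_exp.2 (by linarith)
  rw [Real.cosh_eq, Real.cosh_eq]
  linarith

theorem hmd_pointwise (j η g v w s l : ℝ) (hη : 0 < η) (h : |v - w| ≤ s) (hl : 0 < l) :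
    Real.exp (-j * s) * |g| ≤ (l * (g ^ 2 * Real.cosh w ^ (2 * η))
      + l⁻¹ * ((Real.cosh v ^ (-η)) ^ 2 * Real.exp (-(2 * (j - η)) * s))) / 2 := by
  have hw := Real.cosh_pos w
  have hv := Real.cosh_pos v
  have hX : Real.cosh w ^ (2 * η) = (Real.cosh w ^ η) ^ 2 := by
    rw [mul_comm, Real.rpow_mul hw.le]; norm_cast
  have hE : Real.exp (-(2 * (j - η)) * s) = Real.exp (-(j - η) * s) ^ 2 := by
    rw [← Real.exp_nat_mul]; congr 1; push_cast; ring
  have h1 : Real.cosh v ^ η ≤ Real.cosh w ^ η * Real.exp (η * s) := by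
    have := Real.rpow_le_rpow hv.le (hmd_cosh_le v w s h) hη.le
    rwa [Real.mul_rpow hw.le (Real.exp_pos s).le, ← Real.exp_mul, mul_comm s η] at this
  have h2 : 1 ≤ Real.cosh w ^ η * Real.exp (η * s) * Real.cosh v ^ (-η) := by
    have h3 := mul_le_mul_of_nonneg_right h1 (Real.rpow_pos_of_pos hv (-η)).le
    rwa [← Real.rpow_add hv, add_neg_cancel, Real.rpow_zero] at h3
  have h4 : Real.exp (-j * s) * Real.exp (η * s) = Real.exp (-(j - η) * s) := by
    rw [← Real.exp_add]; congr 1; ring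
  rw [hX, hE]
  have h5 := mul_le_mul_of_nonneg_left h2 (mul_nonneg (Real.exp_pos (-j * s)).le (abs_nonneg g))
  set X := Real.cosh w ^ η
  set Y := Real.cosh v ^ (-η)
  set E := Real.exp (-(j - η) * s)
  have h6 : Real.exp (-j * s) * |g| ≤ (|g| * X) * (Y * E) := by
    rw [← h4]; linarith
  have h7 : 0 ≤ l⁻¹ * (l * (|g| * X) - Y * E) ^ 2 := by positivity
  have h8 : l⁻¹ * (l * (|g| * X) - Y * E) ^ 2
      = l * (g ^ 2 * X ^ 2) + l⁻¹ * (Y ^ 2 * E ^ 2) - 2 * ((|g| * X) * (Y * E)) := by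
    rw [← sq_abs g]; field_simp; ring
  linarith

theorem hmd_core (j η : ℝ) (hj : 1 ≤ j) (h0 : 0 < η) (h1 : η < 1) (Γ : ℝ → ℝ)
    (hΓ : Continuous Γ)
    (hi : MeasureTheory.Integrable (fun w : ℝ => Γ w ^ 2 * Real.cosh w ^ (2 * η)))
    (Ω : ℝ → ℝ) (hΩ : ContDiff ℝ 2 Ω) (M : ℝ) (hM : ∀ v, |Ω v| ≤ M)
    (hode : ∀ v : ℝ, deriv (deriv Ω) v - j ^ 2 * Ω v = Γ v) (v T l : ℝ) (hT : 0 ≤ T)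
    (hl : 0 < l) :
    2 * j * Real.cosh (j * T) * |Ω v| ≤ 2 * j * M + Real.cosh (j * T) *
      (l * (∫ w : ℝ, Γ w ^ 2 * Real.cosh w ^ (2 * η)) +
        l⁻¹ * ((Real.cosh v ^ (-η)) ^ 2 * (1 / (2 * (j - η))))) := by
  have hd1 : ∀ x, HasDerivAt Ω (deriv Ω x) x := fun x =>
    (hΩ.differentiable (by norm_num) x).hasDerivAt
  have hd2 : ∀ x, HasDerivAt (deriv Ω) (j ^ 2 * Ω x + Γ x) x := by
    intro x
    have hc : ContDiff ℝ 1 (deriv Ω) := by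
      have : ContDiff ℝ (1 + 1) Ω := by convert hΩ using 1; norm_num
      exact (contDiff_succ_iff_deriv.1 this).2.2
    have := (hc.differentiable (by norm_num) x).hasDerivAt
    rwa [show deriv (deriv Ω) x = j ^ 2 * Ω x + Γ x by linarith [hode x]] at this
  set q : ℝ → ℝ := fun w => Γ w ^ 2 * Real.cosh w ^ (2 * η) with hq
  have hq0 : ∀ w, 0 ≤ q w := fun w =>
    mul_nonneg (sq_nonneg _) (Real.rpow_nonneg (Real.cosh_pos w).le _)
  have hqc : Continuous q :=
    (hΓ.pow 2).mul (Real.continuous_cosh.rpow_const fun x => Or.inl (Real.cosh_pos x).ne')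
  set Y := Real.cosh v ^ (-η)
  let F : ℝ → ℝ := fun s => Real.sinh (j * (T - s)) * (deriv Ω (v + s) - deriv Ω (v - s))
    + j * (Real.cosh (j * (T - s)) * (Ω (v + s) + Ω (v - s)))
  have hF : ∀ s ∈ Set.uIcc 0 T,
      HasDerivAt F (Real.sinh (j * (T - s)) * (Γ (v + s) + Γ (v - s))) s := by
    intro s _
    have a1 : HasDerivAt (fun s : ℝ => v + s) 1 s := (hasDerivAt_id s).const_add v
    have a2 : HasDerivAt (fun s : ℝ => v - s) (-1) s := (hasDerivAt_id s).const_sub v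
    have a3 : HasDerivAt (fun s : ℝ => j * (T - s)) (j * (-1)) s :=
      ((hasDerivAt_id s).const_sub T).const_mul j
    have b1 := (hd1 (v + s)).comp s a1
    have b2 := (hd1 (v - s)).comp s a2
    have b3 := (hd2 (v + s)).comp s a1
    have b4 := (hd2 (v - s)).comp s a2
    have := (a3.sinh.mul (b3.sub b4)).add ((a3.cosh.mul (b1.add b2)).const_mul j)
    refine HasDerivAt.congr_deriv this ?_
    simp only [Pi.sub_apply, Pi.add_apply, Function.comp]
    ring
  have hcont : Continuous fun s => Real.sinh (j * (T - s)) * (Γ (v + s) + Γ (v - s)) := by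
    fun_prop
  have hint := intervalIntegral.integral_eq_sub_of_hasDerivAt hF (hcont.intervalIntegrable _ _)
  have hFT : F T = j * (Ω (v + T) + Ω (v - T)) := by simp [F]
  have hF0 : F 0 = 2 * j * Real.cosh (j * T) * Ω v := by simp [F]; ring
  have hc0 := Real.cosh_pos (j * T)
  let g : ℝ → ℝ := fun s => Real.cosh (j * T) * ((l / 2) * (q (v + s) + q (v - s))
      + l⁻¹ * Y ^ 2 * Real.exp (-(2 * (j - η)) * s))
  have hg : Continuous g := by fun_prop
  have hle : ∀ s ∈ Set.Ioc 0 T, ‖Real.sinh (j * (T - s)) * (Γ (v + s) + Γ (v - s))‖ ≤ g s := by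
    intro s hs
    have p1 := hmd_pointwise j η (Γ (v + s)) v (v + s) s l h0
      (by rw [show v - (v + s) = -s by ring, abs_neg, abs_of_pos hs.1]) hl
    have p2 := hmd_pointwise j η (Γ (v - s)) v (v - s) s l h0
      (by rw [show v - (v - s) = s by ring, abs_of_pos hs.1]) hl
    have s0 : 0 ≤ Real.sinh (j * (T - s)) :=
      Real.sinh_nonneg_iff.2 (mul_nonneg (by linarith) (by linarith [hs.2]))
    have s1 : Real.sinh (j * (T - s)) ≤ Real.cosh (j * T) * Real.exp (-j * s) := by
      rw [Real.sinh_eq, Real.cosh_eq, show j * (T - s) = j * T + -j * s by ring, Real.exp_add]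
      have := Real.exp_pos (-(j * T + -j * s))
      have := mul_pos (Real.exp_pos (-(j * T))) (Real.exp_pos (-j * s))
      linarith
    rw [norm_mul, Real.norm_eq_abs, Real.norm_eq_abs, abs_of_nonneg s0]
    calc _ ≤ (Real.cosh (j * T) * Real.exp (-j * s)) * (|Γ (v + s)| + |Γ (v - s)|) :=
          mul_le_mul s1 (abs_add_le _ _) (abs_nonneg _) (by positivity)
      _ = Real.cosh (j * T) * (Real.exp (-j * s) * |Γ (v + s)| + Real.exp (-j * s) * |Γ (v - s)|) := by
          ring
      _ ≤ g s := by
          refine mul_le_mul_of_nonneg_left ((add_le_add p1 p2).trans (le_of_eq ?_)) hc0.le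
          simp only [hq, Y]
          ring
  have hb := intervalIntegral.norm_integral_le_of_norm_le hT
    (Filter.Eventually.of_forall hle) (hg.intervalIntegrable (μ := MeasureTheory.volume) 0 T)
  have hq1 : ∫ s in (0:ℝ)..T, q (v + s) ≤ ∫ w, q w := by
    rw [intervalIntegral.integral_comp_add_left (fun x => q x)]
    exact hmd_integral_bound q hq0 hi _ _ (by linarith)
  have hq2 : ∫ s in (0:ℝ)..T, q (v - s) ≤ ∫ w, q w := by
    rw [intervalIntegral.integral_comp_sub_left (fun x => q x)]
    exact hmd_integral_bound q hq0 hi _ _ (by linarith)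
  have hE := hmd_exp_bound (j - η) T (by linarith)
  have hgi : ∫ s in (0:ℝ)..T, g s = Real.cosh (j * T) * ((l / 2) *
      ((∫ s in (0:ℝ)..T, q (v + s)) + ∫ s in (0:ℝ)..T, q (v - s))
      + l⁻¹ * Y ^ 2 * ∫ s in (0:ℝ)..T, Real.exp (-(2 * (j - η)) * s)) := by
    have c1 : Continuous fun s => q (v + s) := by fun_prop
    have c2 : Continuous fun s => q (v - s) := by fun_prop
    have c3 : Continuous fun s => (l / 2) * (q (v + s) + q (v - s)) := by fun_prop
    have c4 : Continuous fun s => l⁻¹ * Y ^ 2 * Real.exp (-(2 * (j - η)) * s) := by fun_prop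
    simp only [g]
    rw [intervalIntegral.integral_const_mul, intervalIntegral.integral_add
      (c3.intervalIntegrable _ _) (c4.intervalIntegrable _ _),
      intervalIntegral.integral_const_mul, intervalIntegral.integral_const_mul,
      intervalIntegral.integral_add (c1.intervalIntegrable _ _) (c2.intervalIntegrable _ _)]
  have hgb : ∫ s in (0:ℝ)..T, g s ≤ Real.cosh (j * T) *
      (l * (∫ w, q w) + l⁻¹ * (Y ^ 2 * (1 / (2 * (j - η))))) := by
    rw [hgi]
    refine mul_le_mul_of_nonneg_left (add_le_add ?_ ?_) hc0.le
    · have := mul_le_mul_of_nonneg_left (add_le_add hq1 hq2) (by positivity : 0 ≤ l / 2)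
      linarith
    · rw [← mul_assoc]
      exact mul_le_mul_of_nonneg_left hE (by positivity)
  rw [hint, hFT, hF0, Real.norm_eq_abs] at hb
  have hA : |j * (Ω (v + T) + Ω (v - T))| ≤ 2 * j * M := by
    rw [abs_mul, abs_of_pos (by linarith : 0 < j)]
    have := mul_le_mul_of_nonneg_left
      ((abs_add_le (Ω (v + T)) (Ω (v - T))).trans (add_le_add (hM _) (hM _)))
      (by linarith : 0 ≤ j)
    linarith
  have hB : |2 * j * Real.cosh (j * T) * Ω v| = 2 * j * Real.cosh (j * T) * |Ω v| := by
    rw [abs_mul, abs_of_pos (by have : 0 < j := by linarith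
                                positivity)]
  have hC := abs_sub_abs_le_abs_sub (2 * j * Real.cosh (j * T) * Ω v)
    (j * (Ω (v + T) + Ω (v - T)))
  rw [abs_sub_comm] at hC
  linarith

theorem higher_mode_decay :
    ∃ C > (0 : ℝ), ∀ j : ℕ, 1 ≤ j → ∀ η ∈ Set.Ioo (0 : ℝ) 1, ∀ Γ : ℝ → ℝ,
      Continuous Γ →
      MeasureTheory.Integrable (fun w : ℝ => Γ w ^ 2 * Real.cosh w ^ (2 * η)) →
      ∀ Ω : ℝ → ℝ, ContDiff ℝ 2 Ω → (∃ M : ℝ, ∀ v : ℝ, |Ω v| ≤ M) →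
      (∀ v : ℝ, deriv (deriv Ω) v - (j : ℝ) ^ 2 * Ω v = Γ v) →
      ∀ v : ℝ,
        |Ω v| ≤ C * ((∫ w : ℝ, Γ w ^ 2 * Real.cosh w ^ (2 * η)) ^ ((1 : ℝ) / 2) / (2 * (j : ℝ)))
          * ((2 * ((j : ℝ) + η)) ^ (-(1 : ℝ) / 2) + (2 * ((j : ℝ) - η)) ^ (-(1 : ℝ) / 2))
          * Real.cosh v ^ (-η) := by
  refine ⟨2, by norm_num, ?_⟩
  rintro j hj η ⟨h0, h1⟩ Γ hΓ hi Ω hΩ ⟨M, hM⟩ hode v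
  have hj' : (1 : ℝ) ≤ j := by exact_mod_cast hj
  have hcore := hmd_core j η hj' h0 h1 Γ hΓ hi Ω hΩ M hM hode v
  have hI : 0 ≤ ∫ w : ℝ, Γ w ^ 2 * Real.cosh w ^ (2 * η) :=
    MeasureTheory.integral_nonneg fun w =>
      mul_nonneg (sq_nonneg _) (Real.rpow_nonneg (Real.cosh_pos w).le _)
  generalize (j : ℝ) = j at *
  generalize (∫ w : ℝ, Γ w ^ 2 * Real.cosh w ^ (2 * η)) = I at *
  have hY : 0 < Real.cosh v ^ (-η) := Real.rpow_pos_of_pos (Real.cosh_pos v) _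
  generalize Real.cosh v ^ (-η) = Y at *
  have ha : 0 < 2 * (j - η) := by linarith
  have hd : 0 < (2 * (j - η)) ^ (-(1 : ℝ) / 2) := Real.rpow_pos_of_pos ha _
  have hd2 : ((2 * (j - η)) ^ (-(1 : ℝ) / 2)) ^ 2 = 1 / (2 * (j - η)) := by
    rw [← Real.rpow_natCast, ← Real.rpow_mul ha.le]
    norm_num [Real.rpow_neg_one]
  have hd' : 0 < (2 * (j + η)) ^ (-(1 : ℝ) / 2) := Real.rpow_pos_of_pos (by linarith) _
  rw [← hd2] at hcore
  generalize (2 * (j - η)) ^ (-(1 : ℝ) / 2) = d at *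
  generalize (2 * (j + η)) ^ (-(1 : ℝ) / 2) = d' at *
  rw [← Real.sqrt_eq_rpow]
  have hKs := Real.sq_sqrt hI
  have hK0 := Real.sqrt_nonneg I
  generalize Real.sqrt I = K at *
  have step1 : ∀ l : ℝ, 0 < l → 2 * j * |Ω v| ≤ l * I + l⁻¹ * (Y ^ 2 * d ^ 2) := by
    intro l hl
    refine le_of_forall_pos_le_add fun ε hε => ?_
    have hM0 : 0 ≤ M := (abs_nonneg _).trans (hM 0)
    have hT : 0 ≤ 2 * j * M / ε := by positivity
    have hc := hcore (2 * j * M / ε) l hT hl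
    have hcp := Real.cosh_pos (j * (2 * j * M / ε))
    have hcl : 2 * j * M / ε ≤ Real.cosh (j * (2 * j * M / ε)) := by
      have e1 : 2 * j * M / ε ≤ j * (2 * j * M / ε) := le_mul_of_one_le_left hT hj'
      have e2 := Real.self_le_sinh_iff.2 (hT.trans e1)
      have e3 := Real.sinh_lt_cosh (j * (2 * j * M / ε))
      linarith
    rw [div_le_iff₀ hε] at hcl
    generalize Real.cosh (j * (2 * j * M / ε)) = c at *
    refine le_of_mul_le_mul_left ?_ hcp
    linarith
  have step2 : 2 * j * |Ω v| ≤ 2 * (K * (Y * d)) := by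
    refine le_of_forall_pos_le_add fun ε hε => ?_
    have hYd : 0 < Y * d := by positivity
    have hδ : 0 < ε / (2 * (Y * d)) := by positivity
    have hδe : ε / (2 * (Y * d)) * (Y * d) * 2 = ε := by field_simp
    generalize ε / (2 * (Y * d)) = δ at *
    have hKδ : 0 < K + δ := by linarith
    have h := step1 (Y * d / (K + δ)) (by positivity)
    have e1 : Y * d / (K + δ) * I ≤ Y * d * (K + δ) := by
      rw [← hKs, div_mul_eq_mul_div, div_le_iff₀ hKδ]
      have : K ^ 2 ≤ (K + δ) * (K + δ) := by nlinarith
      have := mul_le_mul_of_nonneg_left this hYd.le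
      linarith
    have e2 : (Y * d / (K + δ))⁻¹ * (Y ^ 2 * d ^ 2) = Y * d * (K + δ) := by
      field_simp
    linarith
  have hjp : 0 < j := by linarith
  have step3 : |Ω v| ≤ 2 * (K / (2 * j)) * d * Y := by
    have : 2 * (K / (2 * j)) * d * Y = 2 * (K * (Y * d)) / (2 * j) := by field_simp
    rw [this, le_div_iff₀ (by positivity)]
    linarith
  have : 0 ≤ 2 * (K / (2 * j)) * d' * Y := by positivity
  linarith
end

section
/- Let n ≥ 3 be an integer, k ≥ 2 an integer, and q ∈ (−(n−2), 0). Let φ(s) = (cosh((n−1)s))^{1/(n−1)} and define T₀S := S'' + (n−2)·(φ'/φ)·S' + n(n−1)·φ^{2−2n}·S. Then for every C^{k−2} function f : ℝ → ℝ satisfying sup_{s∈ℝ} |f^{(a)}(s)|·φ(s)^{−q} < ∞ for every 0 ≤ a ≤ k−2, there exists a unique C^k function S : ℝ → ℝ satisfying sup_{s∈ℝ} |S^{(a)}(s)|·φ(s)^{−q} < ∞ for every 0 ≤ a ≤ k and T₀S = f on ℝ. In other words, T₀ : C^k_q(ℝ) → C^{k−2}_q(ℝ) is a bijection. -/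
/-- Profile function of the minimal n-catenoid. -/
noncomputable def catProfile (n : ℕ) (s : ℝ) : ℝ :=
  Real.cosh (((n : ℝ) - 1) * s) ^ (1 / ((n : ℝ) - 1))

/-- Radial part of the Jacobi operator of the minimal n-catenoid. -/
noncomputable def T0 (n : ℕ) (S : ℝ → ℝ) (s : ℝ) : ℝ :=
  deriv (deriv S) s
    + ((n : ℝ) - 2) * (deriv (catProfile n) s / catProfile n s) * deriv S s
    + (n : ℝ) * ((n : ℝ) - 1) * catProfile n s ^ (2 - 2 * (n : ℝ)) * S s

/-- Membership in the exponentially weighted space `C^k_q(ℝ)`. -/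
def InWeightedCk (n k : ℕ) (q : ℝ) (h : ℝ → ℝ) : Prop :=
  ContDiff ℝ (k : ℕ) h ∧
    ∀ a : ℕ, a ≤ k → ∃ M : ℝ, ∀ s : ℝ,
      |iteratedDeriv a h s| * catProfile n s ^ (-q) ≤ M


open Real Set Filter Topology

/-- exponential bound -/
def EB (q : ℝ) (h : ℝ → ℝ) : Prop := ∃ M : ℝ, ∀ s : ℝ, |h s| ≤ M * exp (q * |s|)

/-- weighted space, recursive version -/
def Wk (q : ℝ) : ℕ → (ℝ → ℝ) → Prop
  | 0, h => Continuous h ∧ EB q h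
  | k + 1, h => EB q h ∧ Differentiable ℝ h ∧ Wk q k (deriv h)

lemma EB.nonneg {q : ℝ} {h : ℝ → ℝ} (H : EB q h) :
    ∃ M : ℝ, 0 ≤ M ∧ ∀ s : ℝ, |h s| ≤ M * exp (q * |s|) := by
  obtain ⟨M, hM⟩ := H
  refine ⟨M, ?_, hM⟩
  have := hM 0
  simp at this
  exact (abs_nonneg _).trans this

lemma EB.add {q : ℝ} {g h : ℝ → ℝ} (G : EB q g) (H : EB q h) : EB q (fun s => g s + h s) := by
  obtain ⟨M, hM⟩ := G
  obtain ⟨N, hN⟩ := H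
  refine ⟨M + N, fun s => ?_⟩
  have := abs_add_le (g s) (h s)
  have h1 := hM s
  have h2 := hN s
  nlinarith

lemma EB.mul {q r : ℝ} {g h : ℝ → ℝ} (G : EB q g) (H : EB r h) :
    EB (q + r) (fun s => g s * h s) := by
  obtain ⟨M, hM0, hM⟩ := G.nonneg
  obtain ⟨N, hN⟩ := H
  refine ⟨M * N, fun s => ?_⟩
  rw [abs_mul]
  calc |g s| * |h s| ≤ (M * exp (q * |s|)) * (N * exp (r * |s|)) :=
        mul_le_mul (hM s) (hN s) (abs_nonneg _) (by positivity)
    _ = M * N * exp ((q + r) * |s|) := by rw [add_mul, exp_add]; ring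

lemma EB.neg {q : ℝ} {g : ℝ → ℝ} (G : EB q g) : EB q (fun s => - g s) := by
  obtain ⟨M, hM⟩ := G
  exact ⟨M, fun s => by simpa using hM s⟩

lemma Wk.eb {q : ℝ} {k : ℕ} {h : ℝ → ℝ} (H : Wk q k h) : EB q h := by
  cases k with
  | zero => exact H.2
  | succ k => exact H.1

lemma Wk.cont {q : ℝ} {k : ℕ} {h : ℝ → ℝ} (H : Wk q k h) : Continuous h := by
  cases k with
  | zero => exact H.1
  | succ k => exact H.2.1.continuous

lemma Wk.pred {q : ℝ} {k : ℕ} {h : ℝ → ℝ} (H : Wk q (k + 1) h) : Wk q k h := by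
  induction k generalizing h with
  | zero => exact ⟨H.2.1.continuous, H.1⟩
  | succ k ih => exact ⟨H.1, H.2.1, ih H.2.2⟩

lemma Wk.mono {q : ℝ} {j k : ℕ} (hjk : j ≤ k) {h : ℝ → ℝ} (H : Wk q k h) : Wk q j h := by
  induction hjk with
  | refl => exact H
  | step _ ih => exact ih H.pred

lemma Wk.add {q : ℝ} {k : ℕ} {g h : ℝ → ℝ} (G : Wk q k g) (H : Wk q k h) :
    Wk q k (fun s => g s + h s) := by
  induction k generalizing g h with
  | zero => exact ⟨G.1.add H.1, G.2.add H.2⟩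
  | succ k ih =>
    refine ⟨G.1.add H.1, G.2.1.add H.2.1, ?_⟩
    have : deriv (fun s => g s + h s) = fun s => deriv g s + deriv h s := by
      funext s
      exact deriv_fun_add (G.2.1 s) (H.2.1 s)
    rw [this]
    exact ih G.2.2 H.2.2

lemma Wk.mul {q r : ℝ} {k : ℕ} {g h : ℝ → ℝ} (G : Wk q k g) (H : Wk r k h) :
    Wk (q + r) k (fun s => g s * h s) := by
  induction k generalizing g h with
  | zero => exact ⟨G.1.mul H.1, G.2.mul H.2⟩
  | succ k ih =>
    refine ⟨G.1.mul H.1, G.2.1.mul H.2.1, ?_⟩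
    have : deriv (fun s => g s * h s) = fun s => deriv g s * h s + g s * deriv h s := by
      funext s
      exact deriv_fun_mul (G.2.1 s) (H.2.1 s)
    rw [this]
    exact (ih G.2.2 H.pred).add (ih G.pred H.2.2)

lemma Wk.const (c : ℝ) (k : ℕ) : Wk 0 k (fun _ => c) := by
  induction k generalizing c with
  | zero => exact ⟨continuous_const, |c|, fun s => by simp⟩
  | succ k ih =>
    refine ⟨⟨|c|, fun s => by simp⟩, differentiable_const _, ?_⟩
    simpa using ih 0

lemma Wk.mul0 {r : ℝ} {k : ℕ} {g h : ℝ → ℝ} (G : Wk 0 k g) (H : Wk r k h) :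
    Wk r k (fun s => g s * h s) := by
  have := G.mul H
  rwa [zero_add] at this

lemma Wk.bootstrap {q : ℝ} {j : ℕ} {f S a b : ℝ → ℝ} (hf : Wk q j f) (ha : Wk 0 j a)
    (hb : Wk 0 j b) (hS : EB q S) (hS1 : EB q (deriv S)) (dS : Differentiable ℝ S)
    (dS1 : Differentiable ℝ (deriv S))
    (eq : ∀ s, deriv (deriv S) s = f s + (a s * deriv S s + b s * S s)) : Wk q (j + 2) S := by
  have key : ∀ i, i ≤ j + 1 → Wk q (i + 1) S := by
    intro i
    induction i with
    | zero => exact fun _ => ⟨hS, dS, dS1.continuous, hS1⟩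
    | succ i ih =>
      intro hi
      have h1 := ih (by omega)
      have hij : i ≤ j := by omega
      refine ⟨hS, dS, hS1, dS1, ?_⟩
      rw [show deriv (deriv S) = _ from funext eq]
      exact (hf.mono hij).add (((ha.mono hij).mul0 h1.2.2).add ((hb.mono hij).mul0 h1.pred))
  exact key (j + 1) le_rfl

lemma Wk.of_deriv_eq {m : ℝ} {u : ℝ → ℝ} (hu : ∀ s, HasDerivAt u (m * (1 - u s ^ 2)) s)
    (hb : ∀ s, |u s| ≤ 1) (k : ℕ) : Wk 0 k u := by
  have h0 : EB 0 u := ⟨1, fun s => by simpa using hb s⟩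
  have hd : Differentiable ℝ u := fun s => (hu s).differentiableAt
  induction k with
  | zero => exact ⟨hd.continuous, h0⟩
  | succ k ih =>
    refine ⟨h0, hd, ?_⟩
    have : deriv u = fun s => m + (-m) * (u s * u s) := by
      funext s
      rw [(hu s).deriv]; ring
    rw [this]
    exact (Wk.const m k).add ((Wk.const (-m) k).mul0 (ih.mul0 ih))

/-- profile bounds -/
lemma cosh_upper (x : ℝ) : cosh x ≤ exp |x| := by
  rw [← cosh_abs, cosh_eq]
  have : exp (-|x|) ≤ exp |x| := exp_le_exp.2 (by linarith [abs_nonneg x])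
  linarith

lemma cosh_lower (x : ℝ) : exp |x| / 2 ≤ cosh x := by
  rw [← cosh_abs, cosh_eq]
  have := exp_pos (-|x|)
  linarith

lemma catProfile_pos (n : ℕ) (s : ℝ) : 0 < catProfile n s := rpow_pos_of_pos (cosh_pos _) _

lemma catProfile_upper (n : ℕ) (hn : 3 ≤ n) (s : ℝ) : catProfile n s ≤ exp |s| := by
  have hm : (3 : ℝ) ≤ n := by exact_mod_cast hn
  unfold catProfile
  calc _ ≤ (exp |((n : ℝ) - 1) * s|) ^ (1 / ((n : ℝ) - 1)) :=
        rpow_le_rpow (cosh_pos _).le (cosh_upper _) (by apply div_nonneg <;> linarith)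
    _ = exp |s| := by
        rw [← exp_mul, abs_mul, abs_of_pos (by linarith : (0 : ℝ) < n - 1)]
        congr 1
        have : (n : ℝ) - 1 ≠ 0 := by linarith
        field_simp

lemma catProfile_lower (n : ℕ) (hn : 3 ≤ n) (s : ℝ) : exp |s| / 2 ≤ catProfile n s := by
  have hm : (3 : ℝ) ≤ n := by exact_mod_cast hn
  have h1 : 0 ≤ 1 / ((n : ℝ) - 1) := by apply div_nonneg <;> linarith
  have h2 : 1 / ((n : ℝ) - 1) ≤ 1 := by rw [div_le_one] <;> linarith
  unfold catProfile
  calc exp |s| / 2 ≤ exp |s| / 2 ^ (1 / ((n : ℝ) - 1)) := by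
        gcongr
        exact rpow_le_self_of_one_le (by norm_num) h2
    _ = (exp |((n : ℝ) - 1) * s| / 2) ^ (1 / ((n : ℝ) - 1)) := by
        rw [div_rpow (exp_pos _).le (by norm_num), ← exp_mul, abs_mul,
          abs_of_pos (by linarith : (0 : ℝ) < n - 1)]
        congr 2
        have : (n : ℝ) - 1 ≠ 0 := by linarith
        field_simp
    _ ≤ _ := rpow_le_rpow (by positivity) (cosh_lower _) h1

lemma bound_iff (n : ℕ) (hn : 3 ≤ n) {q : ℝ} (hq : q ≤ 0) (h : ℝ → ℝ) :
    (∃ M : ℝ, ∀ s : ℝ, |h s| * catProfile n s ^ (-q) ≤ M) ↔ EB q h := by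
  have up : ∀ s, catProfile n s ^ (-q) ≤ exp (-q * |s|) := fun s => by
    rw [mul_comm, exp_mul]
    exact rpow_le_rpow (catProfile_pos n s).le (catProfile_upper n hn s) (by linarith)
  have lo : ∀ s, exp (-q * |s|) / 2 ^ (-q) ≤ catProfile n s ^ (-q) := fun s => by
    rw [mul_comm (-q), exp_mul, ← div_rpow (exp_pos _).le (by norm_num)]
    exact rpow_le_rpow (by positivity) (catProfile_lower n hn s) (by linarith)
  have e : ∀ s, exp (-q * |s|) * exp (q * |s|) = 1 := fun s => by rw [← exp_add]; simp
  have c2 : (0 : ℝ) < 2 ^ (-q) := by positivity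
  constructor
  · rintro ⟨M, hM⟩
    refine ⟨M * 2 ^ (-q), fun s => ?_⟩
    have h1 : |h s| * (exp (-q * |s|) / 2 ^ (-q)) ≤ M :=
      (mul_le_mul_of_nonneg_left (lo s) (abs_nonneg _)).trans (hM s)
    calc |h s| = |h s| * (exp (-q * |s|) / 2 ^ (-q)) * (2 ^ (-q) * exp (q * |s|)) := by
          have := e s
          field_simp
          rw [mul_assoc, ← neg_mul] 
          linear_combination (-|h s|) * this
      _ ≤ M * (2 ^ (-q) * exp (q * |s|)) := by gcongr
      _ = _ := by ring
  · rintro ⟨M, hM⟩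
    refine ⟨M, fun s => ?_⟩
    calc |h s| * catProfile n s ^ (-q) ≤ (M * exp (q * |s|)) * exp (-q * |s|) :=
          mul_le_mul (hM s) (up s) (rpow_nonneg (catProfile_pos n s).le _)
            ((abs_nonneg _).trans (hM s))
      _ = M := by linear_combination M * e s

lemma weighted_iff (n : ℕ) (hn : 3 ≤ n) {q : ℝ} (hq : q ≤ 0) (k : ℕ) (h : ℝ → ℝ) :
    InWeightedCk n k q h ↔ Wk q k h := by
  have aux : ∀ h : ℝ → ℝ, InWeightedCk n k q h ↔
      (ContDiff ℝ (k : ℕ) h ∧ ∀ a ≤ k, EB q (iteratedDeriv a h)) := fun h => by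
    unfold InWeightedCk
    simp only [bound_iff n hn hq]
  rw [aux]
  clear aux
  induction k generalizing h with
  | zero => simp [Wk]
  | succ k ih =>
    simp only [Wk]
    rw [show Wk q k (deriv h) ↔ _ from (ih (deriv h)).symm, Nat.cast_succ, contDiff_succ_iff_deriv]
    constructor
    · rintro ⟨⟨h1, -, h2⟩, h3⟩
      refine ⟨by simpa using h3 0 (by omega), h1, h2, fun a ha => ?_⟩
      rw [← iteratedDeriv_succ']
      exact h3 _ (by omega)
    · rintro ⟨h1, h2, h3, h4⟩
      refine ⟨⟨h2, by simp, h3⟩, fun a ha => ?_⟩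
      cases a with
      | zero => simpa using h1
      | succ a =>
        rw [iteratedDeriv_succ']
        exact h4 a (by omega)

/-- antiderivative vanishing at minus infinity -/
lemma exists_antideriv {r₁ r₂ C : ℝ} (h1 : 0 < r₁) (h2 : 0 < r₂) {g : ℝ → ℝ} (hg : Continuous g)
    (b1 : ∀ t ≤ 0, |g t| ≤ C * exp (r₁ * t)) (b2 : ∀ t, 0 ≤ t → |g t| ≤ C * exp (r₂ * t)) :
    ∃ (G : ℝ → ℝ) (D : ℝ), 0 ≤ D ∧ (∀ s, HasDerivAt G (g s) s) ∧
      (∀ s ≤ 0, |G s| ≤ D * exp (r₁ * s)) ∧ (∀ s, 0 ≤ s → |G s| ≤ D * exp (r₂ * s)) := by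
  have C0 : 0 ≤ C := by
    have := b1 0 le_rfl
    simp at this
    exact (abs_nonneg _).trans this
  have hint : ∀ s ≤ 0, MeasureTheory.IntegrableOn g (Iic s) := fun s hs => by
    refine MeasureTheory.Integrable.mono' ((integrableOn_exp_mul_Iic h1 s).const_mul C)
      hg.aestronglyMeasurable.restrict ?_
    refine (MeasureTheory.ae_restrict_iff' measurableSet_Iic).2 (Eventually.of_forall ?_)
    intro t ht
    exact b1 t (le_trans ht hs)
  set A := ∫ t in Iic (0 : ℝ), g t with hA
  have hbd : ∀ s ≤ 0, |A + ∫ t in (0 : ℝ)..s, g t| ≤ C / r₁ * exp (r₁ * s) := fun s hs => by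
    rw [← intervalIntegral.integral_Iic_sub_Iic (hint 0 le_rfl) (hint s hs), hA]
    rw [add_sub_cancel]
    calc |∫ t in Iic s, g t| ≤ ∫ t in Iic s, C * exp (r₁ * t) := by
          rw [← Real.norm_eq_abs]
          refine MeasureTheory.norm_integral_le_of_norm_le
            ((integrableOn_exp_mul_Iic h1 s).const_mul C) ?_
          refine (MeasureTheory.ae_restrict_iff' measurableSet_Iic).2 (Eventually.of_forall ?_)
          intro t ht
          exact b1 t (le_trans ht hs)
      _ = _ := by
          rw [MeasureTheory.integral_const_mul, integral_exp_mul_Iic h1]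
          ring
  refine ⟨fun s => A + ∫ t in (0 : ℝ)..s, g t, C / r₁ + C / r₂, by positivity, ?_, ?_, ?_⟩
  · intro s
    have h3 : HasDerivAt (fun s => ∫ t in (0 : ℝ)..s, g t) (g s) s :=
      intervalIntegral.integral_hasDerivAt_right (hg.intervalIntegrable _ _)
        (hg.stronglyMeasurableAtFilter _ _) hg.continuousAt
    exact h3.const_add A
  · intro s hs
    refine (hbd s hs).trans ?_
    have : 0 ≤ C / r₂ := by positivity
    gcongr
    linarith
  · intro s hs
    have hA' : |A| ≤ C / r₁ := by simpa using hbd 0 le_rfl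
    have hI : |∫ t in (0 : ℝ)..s, g t| ≤ C / r₂ * (exp (r₂ * s) - 1) := by
      have h3 : |∫ t in (0 : ℝ)..s, g t| ≤ ∫ t in (0 : ℝ)..s, C * exp (r₂ * t) := by
        have hc : Continuous fun t : ℝ => C * exp (r₂ * t) := by fun_prop
        rw [← Real.norm_eq_abs]
        refine intervalIntegral.norm_integral_le_of_norm_le hs ?_ (hc.intervalIntegrable _ _)
        exact Eventually.of_forall fun t ht => b2 t ht.1.le
      have h4 : ∫ t in (0 : ℝ)..s, C * exp (r₂ * t) = C / r₂ * exp (r₂ * s) - C / r₂ * exp (r₂ * 0) := by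
        refine intervalIntegral.integral_eq_sub_of_hasDerivAt
          (f := fun t => C / r₂ * exp (r₂ * t)) ?_
          (Continuous.intervalIntegrable (by fun_prop) _ _)
        intro t _
        have := ((((hasDerivAt_id t).const_mul r₂).exp).const_mul (C / r₂))
        refine this.congr_deriv ?_
        field_simp
        simp
      rw [h4] at h3
      simpa [mul_sub] using h3
    have h5 : 1 ≤ exp (r₂ * s) := one_le_exp (by positivity)
    have h6 : C / r₁ ≤ C / r₁ * exp (r₂ * s) := le_mul_of_one_le_right (by positivity) h5
    have h7 : 0 ≤ C / r₂ := by positivity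
    have := abs_add_le A (∫ t in (0 : ℝ)..s, g t)
    simp only
    linarith

lemma eb_of_halves {q C : ℝ} {h : ℝ → ℝ} (b1 : ∀ s ≤ 0, |h s| ≤ C * exp (-q * s))
    (b2 : ∀ s, 0 ≤ s → |h s| ≤ C * exp (q * s)) : EB q h := by
  refine ⟨C, fun s => ?_⟩
  rcases le_total s 0 with hs | hs
  · rw [abs_of_nonpos hs]
    have := b1 s hs
    rwa [show q * -s = -q * s by ring]
  · rw [abs_of_nonneg hs]
    exact b2 s hs

/-- ODE data -/
structure Data (m : ℝ) (u ρ p : ℝ → ℝ) : Prop where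
  hm : 2 ≤ m
  hu : ∀ s, HasDerivAt u (m * (1 - u s ^ 2)) s
  hρ : ∀ s, HasDerivAt ρ (-(m - 1) * u s * ρ s) s
  hp : ∀ s, HasDerivAt p ((m - 1) * u s * p s) s
  u1 : ∀ s, |u s| ≤ 1
  uodd : ∀ s, u (-s) = -u s
  ρeven : ∀ s, ρ (-s) = ρ s
  peven : ∀ s, p (-s) = p s
  ρpos : ∀ s, 0 < ρ s
  pρ : ∀ s, p s * ρ s = 1
  ρle : ∀ s, ρ s ≤ 2 * exp (-(m - 1) * |s|)
  ple : ∀ s, p s ≤ exp ((m - 1) * |s|)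
  ulim : Tendsto u atTop (𝓝 1)

lemma exists_psi {m : ℝ} {u ρ p : ℝ → ℝ} (d : Data m u ρ p) :
    ∃ (ψ : ℝ → ℝ) (P D : ℝ), 0 < P ∧ 0 ≤ D ∧ (∀ s, HasDerivAt ψ (ρ s) s) ∧ (∀ s, ψ (-s) = -ψ s) ∧
      (∀ s, |ψ s| ≤ P) ∧ (∀ s, 0 ≤ s → |P - ψ s| ≤ D * exp (-(m - 1) * s)) := by
  have hm := d.hm
  obtain ⟨G, D, D0, hG, hb, -⟩ := exists_antideriv (r₁ := m - 1) (r₂ := m - 1) (C := 2)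
    (by linarith) (by linarith)
    (g := ρ) (continuous_iff_continuousAt.2 fun s => (d.hρ s).continuousAt)
    (fun t ht => by
      rw [abs_of_pos (d.ρpos t)]
      have := d.ρle t
      rw [abs_of_nonpos ht] at this
      rwa [show (m - 1) * t = -(m - 1) * -t by ring])
    (fun t ht => by
      rw [abs_of_pos (d.ρpos t)]
      have := d.ρle t
      rw [abs_of_nonneg ht] at this
      refine this.trans ?_
      gcongr
      linarith)
  have mono : StrictMono G := strictMono_of_deriv_pos fun s => by
    rw [(hG s).deriv]; exact d.ρpos s
  have lim : Tendsto G atBot (𝓝 0) := by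
    refine squeeze_zero_norm' (a := fun s => D * exp ((m - 1) * s)) ?_ ?_
    · filter_upwards [Iic_mem_atBot 0] with s hs using hb s hs
    · have : Tendsto (fun s : ℝ => (m - 1) * s) atBot atBot :=
        tendsto_id.const_mul_atBot (by linarith)
      simpa using (tendsto_exp_atBot.comp this).const_mul D
  have G0 : ∀ s, 0 ≤ G s := fun s => mono.monotone.le_of_tendsto lim s
  have P0 : 0 < G 0 := (G0 (-1)).trans_lt (mono (by norm_num))
  have odd : ∀ s, G (-s) - G 0 = -(G s - G 0) := fun s => by
    have h1 : ∀ s, HasDerivAt (fun s => G s + G (-s)) 0 s := fun s => by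
      have := (hG s).add ((hG (-s)).scomp s (hasDerivAt_neg s))
      refine this.congr_deriv ?_
      rw [d.ρeven]; simp
    have h2 := is_const_of_deriv_eq_zero (fun s => (h1 s).differentiableAt) (fun s => (h1 s).deriv)
      s 0
    simp at h2
    linarith
  refine ⟨fun s => G s - G 0, G 0, D, P0, D0, fun s => (hG s).sub_const _, odd, ?_, ?_⟩
  · intro s
    have h1 := G0 s
    have h2 := G0 (-s)
    have h3 := odd s
    rw [abs_le]
    constructor <;> linarith
  · intro s hs
    have h1 := hb (-s) (by linarith)
    have h3 := odd s
    rw [show G 0 - (G s - G 0) = G (-s) by linarith]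
    rwa [show -(m - 1) * s = (m - 1) * -s by ring]

/-- Jacobi fields -/
noncomputable def yf (u ρ ψ : ℝ → ℝ) (c : ℝ) (s : ℝ) : ℝ := (c - ψ s) * u s + ρ s

/-- derivative of the Jacobi fields -/
noncomputable def yd (m : ℝ) (u ρ ψ : ℝ → ℝ) (c : ℝ) (s : ℝ) : ℝ :=
  (c - ψ s) * (m * (1 - u s ^ 2)) - m * ρ s * u s

lemma yf_deriv {m : ℝ} {u ρ p ψ : ℝ → ℝ} (d : Data m u ρ p) (hψ : ∀ s, HasDerivAt ψ (ρ s) s)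
    (c s : ℝ) : HasDerivAt (yf u ρ ψ c) (yd m u ρ ψ c s) s := by
  have := (((hψ s).const_sub c).mul (d.hu s)).add (d.hρ s)
  refine this.congr_deriv ?_
  unfold yd
  ring

lemma yd_deriv {m : ℝ} {u ρ p ψ : ℝ → ℝ} (d : Data m u ρ p) (hψ : ∀ s, HasDerivAt ψ (ρ s) s)
    (c s : ℝ) : HasDerivAt (yd m u ρ ψ c)
      (-((m - 1) * u s) * yd m u ρ ψ c s - m * (m + 1) * (1 - u s ^ 2) * yf u ρ ψ c s) s := by
  have := (((hψ s).const_sub c).mul ((((d.hu s).pow 2).const_sub 1).const_mul m)).sub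
    (((d.hρ s).const_mul m).mul (d.hu s))
  refine this.congr_deriv ?_
  unfold yd yf
  simp only [Pi.pow_apply]
  push_cast
  ring

lemma wronskian {m : ℝ} {u ρ p ψ : ℝ → ℝ} (d : Data m u ρ p)
    (c e s : ℝ) :
    p s * (yf u ρ ψ c s * yd m u ρ ψ e s - yd m u ρ ψ c s * yf u ρ ψ e s) = m * (e - c) := by
  have := d.pρ s
  unfold yd yf
  linear_combination (m * (e - c)) * this

lemma wronskian_const {m : ℝ} {u ρ p ψ S T : ℝ → ℝ} (d : Data m u ρ p)
    (hψ : ∀ s, HasDerivAt ψ (ρ s) s) (hS : ∀ s, HasDerivAt S (T s) s)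
    (hT : ∀ s, HasDerivAt T (-((m - 1) * u s) * T s - m * (m + 1) * (1 - u s ^ 2) * S s) s)
    (c : ℝ) : ∃ A, ∀ s, p s * (yf u ρ ψ c s * T s - yd m u ρ ψ c s * S s) = A := by
  have h1 : ∀ s, HasDerivAt (fun s => p s * (yf u ρ ψ c s * T s - yd m u ρ ψ c s * S s)) 0 s := by
    intro s
    have := (d.hp s).mul (((yf_deriv d hψ c s).mul (hT s)).sub ((yd_deriv d hψ c s).mul (hS s)))
    refine this.congr_deriv ?_
    simp
    ring
  exact ⟨_, fun s => is_const_of_deriv_eq_zero (fun s => (h1 s).differentiableAt)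
      (fun s => (h1 s).deriv) s 0⟩

lemma uniq {m q : ℝ} {u ρ p S T : ℝ → ℝ} (d : Data m u ρ p) (hq : q < 0) (hSq : EB q S)
    (hS : ∀ s, HasDerivAt S (T s) s)
    (hT : ∀ s, HasDerivAt T (-((m - 1) * u s) * T s - m * (m + 1) * (1 - u s ^ 2) * S s) s) :
    ∀ s, S s = 0 := by
  have hm := d.hm
  obtain ⟨ψ, P, D, P0, D0, hψ, odd, bψ, dψ⟩ := exists_psi d
  obtain ⟨A, hA⟩ := wronskian_const d hψ hS hT P
  obtain ⟨B, hB⟩ := wronskian_const d hψ hS hT (-P)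
  have rep : ∀ s, 2 * m * P * S s = B * yf u ρ ψ P s - A * yf u ρ ψ (-P) s := fun s => by
    have h1 := hA s
    have h2 := hB s
    have h3 := wronskian (ψ := ψ) d P (-P) s
    linear_combination (S s) * h3 + (yf u ρ ψ P s) * h2 - (yf u ρ ψ (-P) s) * h1
  have elim : ∀ r : ℝ, 0 < r → Tendsto (fun s : ℝ => exp (-r * s)) atTop (𝓝 0) := fun r hr =>
    tendsto_exp_atBot.comp (tendsto_id.const_mul_atTop_of_neg (by linarith))
  have limψ : Tendsto ψ atTop (𝓝 P) := by
    have : Tendsto (fun s => P - ψ s) atTop (𝓝 0) := by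
      refine squeeze_zero_norm' (a := fun s => D * exp (-(m - 1) * s)) ?_ ?_
      · filter_upwards [Ici_mem_atTop 0] with s hs using dψ s hs
      · simpa using (elim (m - 1) (by linarith)).const_mul D
    simpa using this.const_sub P
  have limρ : Tendsto ρ atTop (𝓝 0) := by
    refine squeeze_zero_norm' (a := fun s => 2 * exp (-(m - 1) * s)) ?_ ?_
    · filter_upwards [Ici_mem_atTop 0] with s hs
      have := d.ρle s
      rw [abs_of_nonneg hs] at this
      rwa [Real.norm_eq_abs, abs_of_pos (d.ρpos s)]
    · simpa using (elim (m - 1) (by linarith)).const_mul 2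
  have limy : ∀ c, Tendsto (yf u ρ ψ c) atTop (𝓝 (c - P)) := fun c => by
    have := ((limψ.const_sub c).mul d.ulim).add limρ
    simp only [mul_one, add_zero] at this
    exact this
  have refl : ∀ c s, yf u ρ ψ c (-s) = yf u ρ ψ (-c) s := fun c s => by
    unfold yf
    rw [odd, d.uodd, d.ρeven]; ring
  obtain ⟨M, hM⟩ := hSq
  have limM : Tendsto (fun s : ℝ => M * exp (q * s)) atTop (𝓝 0) := by
    simpa using (elim (-q) (by linarith)).const_mul M
  have limS : Tendsto S atTop (𝓝 0) := by
    refine squeeze_zero_norm' ?_ limM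
    filter_upwards [Ici_mem_atTop 0] with s hs
    have := hM s
    rwa [abs_of_nonneg (a := s) hs] at this
  have limS' : Tendsto (fun s => S (-s)) atTop (𝓝 0) := by
    refine squeeze_zero_norm' ?_ limM
    filter_upwards [Ici_mem_atTop 0] with s hs
    have := hM (-s)
    rwa [abs_neg, abs_of_nonneg (a := s) hs] at this
  have e1 : A = 0 := by
    have h1 := limS.const_mul (2 * m * P)
    have h2 := ((limy P).const_mul B).sub ((limy (-P)).const_mul A)
    have h3 := tendsto_nhds_unique h1 (h2.congr fun s => (rep s).symm)
    have : A * P = 0 := by linarith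
    exact (mul_eq_zero.1 this).resolve_right P0.ne'
  have e2 : B = 0 := by
    have h1 := limS'.const_mul (2 * m * P)
    have h2 := ((limy (-P)).const_mul B).sub ((limy P).const_mul A)
    have h3 := tendsto_nhds_unique h1 (h2.congr fun s => by
      rw [rep (-s), refl, refl, neg_neg])
    have : B * P = 0 := by linarith
    exact (mul_eq_zero.1 this).resolve_right P0.ne'
  intro s
  have := rep s
  rw [e1, e2] at this
  have h4 : 2 * m * P ≠ 0 := by positivity
  simpa [h4, P0.ne', show m ≠ 0 by linarith] using this

lemma exist {m q : ℝ} {u ρ p f : ℝ → ℝ} (d : Data m u ρ p) (hq : q < 0) (hq' : -(m - 1) < q)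
    (hfc : Continuous f) (hf : EB q f) :
    ∃ S T : ℝ → ℝ, EB q S ∧ EB q T ∧ (∀ s, HasDerivAt S (T s) s) ∧
      ∀ s, HasDerivAt T (f s + (-((m - 1) * u s) * T s + -(m * (m + 1) * (1 - u s ^ 2)) * S s)) s := by
  have hm := d.hm
  obtain ⟨ψ, P, D, P0, D0, hψ, odd, bψ, dψ⟩ := exists_psi d
  set y := yf u ρ ψ with hy
  set z := yd m u ρ ψ with hz
  have refl : ∀ c s, y c (-s) = y (-c) s := fun c s => by
    simp only [hy, yf]
    rw [odd, d.uodd, d.ρeven]; ring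
  have reflz : ∀ c s, z c (-s) = -z (-c) s := fun c s => by
    simp only [hz, yd]
    rw [odd, d.uodd, d.ρeven]; ring
  have hy' : ∀ c s, HasDerivAt (y c) (z c s) s := yf_deriv d hψ
  have hz' := yd_deriv d hψ
  rw [← hy, ← hz] at hz'
  have usq : ∀ s, 0 ≤ u s ^ 2 ∧ u s ^ 2 ≤ 1 := fun s =>
    ⟨sq_nonneg _, (sq_le_one_iff_abs_le_one _).2 (d.u1 s)⟩
  -- bounds in terms of `|P - ψ|` and `ρ`
  have by0 : ∀ s, |y P s| ≤ m * (|P - ψ s| + ρ s) := fun s => by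
    simp only [hy, yf]
    have h1 := abs_add_le ((P - ψ s) * u s) (ρ s)
    rw [abs_mul, abs_of_pos (d.ρpos s)] at h1
    have h2 : |P - ψ s| * |u s| ≤ |P - ψ s| := mul_le_of_le_one_right (abs_nonneg _) (d.u1 s)
    nlinarith [abs_nonneg (P - ψ s), d.ρpos s]
  have bz0 : ∀ s, |z P s| ≤ m * (|P - ψ s| + ρ s) := fun s => by
    simp only [hz, yd]
    have h1 := abs_sub ((P - ψ s) * (m * (1 - u s ^ 2))) (m * ρ s * u s)
    rw [abs_mul, abs_mul (m * ρ s), abs_of_pos (show 0 < m * ρ s from mul_pos (by linarith) (d.ρpos s)),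
      abs_of_nonneg (show 0 ≤ m * (1 - u s ^ 2) from
        mul_nonneg (by linarith) (by linarith [(usq s).2]))] at h1
    have h2 : |P - ψ s| * (m * (1 - u s ^ 2)) ≤ |P - ψ s| * m :=
      mul_le_mul_of_nonneg_left (by nlinarith [(usq s).1]) (abs_nonneg _)
    have h3 : m * ρ s * |u s| ≤ m * ρ s :=
      mul_le_of_le_one_right (mul_nonneg (by linarith) (d.ρpos s).le) (d.u1 s)
    linarith
  set K := m * (2 * P + D + 2) with hK
  have K0 : 0 ≤ K := by positivity
  have bp : ∀ s, 0 ≤ s → m * (|P - ψ s| + ρ s) ≤ K * exp (-(m - 1) * s) := fun s hs => by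
    have h1 := dψ s hs
    have h2 := d.ρle s
    rw [abs_of_nonneg hs] at h2
    rw [hK, mul_assoc]
    have := exp_pos (-(m - 1) * s)
    gcongr
    nlinarith
  have bn : ∀ s, m * (|P - ψ s| + ρ s) ≤ K := fun s => by
    have h1 := abs_sub P (ψ s)
    have h3 := bψ s
    rw [abs_of_pos P0] at h1
    have h2 := d.ρle s
    have h4 : exp (-(m - 1) * |s|) ≤ 1 := exp_le_one_iff.2 (by
      have := abs_nonneg s
      nlinarith)
    rw [hK]
    exact mul_le_mul_of_nonneg_left (by linarith) (by linarith)
  have p0 : ∀ s, 0 < p s := fun s => by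
    have h1 := d.pρ s
    have h2 := d.ρpos s
    by_contra h
    nlinarith
  -- antiderivative lemma applied to both f and its reflection
  have yc : ∀ c, Continuous (y c) := fun c =>
    continuous_iff_continuousAt.2 fun s => (hy' c s).continuousAt
  have pc : Continuous p := continuous_iff_continuousAt.2 fun s => (d.hp s).continuousAt
  have half : ∀ g : ℝ → ℝ, Continuous g → EB q g → ∃ G : ℝ → ℝ,
      (∀ s, HasDerivAt G (p s * y (-P) s * g s) s) ∧ EB q (fun s => y P s * G s) ∧
      EB q (fun s => z P s * G s) := by
    intro g gc hg
    obtain ⟨M, M0, hM⟩ := hg.nonneg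
    obtain ⟨G, E, E0, hG, b1, b2⟩ := exists_antideriv (r₁ := -q) (r₂ := m - 1 + q) (C := K * M)
      (by linarith) (by linarith) (g := fun s => p s * y (-P) s * g s)
      ((pc.mul (yc _)).mul gc)
      (fun t ht => by
        have h1 := (by0 (-t)).trans (bp (-t) (by linarith))
        rw [refl] at h1
        have h2 := d.ple t
        have h3 := hM t
        rw [abs_of_nonpos ht] at h2 h3
        rw [abs_mul, abs_mul, abs_of_pos (p0 t)]
        calc p t * |y (-P) t| * |g t| ≤ exp ((m - 1) * -t) * (K * exp (-(m - 1) * -t)) *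
              (M * exp (q * -t)) := by
              gcongr
          _ = K * M * (exp ((m - 1) * -t + -(m - 1) * -t) * exp (q * -t)) := by
              rw [exp_add]; ring
          _ = K * M * exp (-q * t) := by
              rw [← exp_add]; congr 2; ring)
      (fun t ht => by
        have h1 := (by0 (-t)).trans (bn (-t))
        rw [refl] at h1
        have h2 := d.ple t
        have h3 := hM t
        rw [abs_of_nonneg ht] at h2 h3
        rw [abs_mul, abs_mul, abs_of_pos (p0 t)]
        calc p t * |y (-P) t| * |g t| ≤ exp ((m - 1) * t) * K * (M * exp (q * t)) := by
              gcongr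
          _ = K * M * (exp ((m - 1) * t) * exp (q * t)) := by ring
          _ = K * M * exp ((m - 1 + q) * t) := by
              rw [← exp_add]; congr 2; ring)
    have gen : ∀ w : ℝ → ℝ, (∀ s, |w s| ≤ m * (|P - ψ s| + ρ s)) → EB q (fun s => w s * G s) := by
      intro w hw
      refine eb_of_halves (C := K * E) ?_ ?_
      · intro s hs
        rw [abs_mul]
        calc |w s| * |G s| ≤ K * (E * exp (-q * s)) :=
              mul_le_mul ((hw s).trans (bn s)) (b1 s hs) (abs_nonneg _) K0
          _ = _ := by ring
      · intro s hs
        rw [abs_mul]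
        calc |w s| * |G s| ≤ (K * exp (-(m - 1) * s)) * (E * exp ((m - 1 + q) * s)) :=
              mul_le_mul ((hw s).trans (bp s hs)) (b2 s hs) (abs_nonneg _) (by positivity)
          _ = K * E * (exp (-(m - 1) * s) * exp ((m - 1 + q) * s)) := by ring
          _ = _ := by rw [← exp_add]; congr 2; ring
    exact ⟨G, hG, gen _ by0, gen _ bz0⟩
  have EBrefl : ∀ h : ℝ → ℝ, EB q h → EB q (fun s => h (-s)) := fun h ⟨M, hM⟩ =>
    ⟨M, fun s => by simpa using hM (-s)⟩
  obtain ⟨G, hG, G1, G2⟩ := half f hfc hf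
  obtain ⟨H, hH, H1, H2⟩ := half (fun s => f (-s)) (hfc.comp continuous_neg) (EBrefl f hf)
  have hH' : ∀ s, HasDerivAt (fun s => H (-s)) (-(p s * y P s * f s)) s := fun s => by
    have := (hH (-s)).scomp s (hasDerivAt_neg s)
    refine this.congr_deriv ?_
    rw [d.peven, refl]; simp
  have H1' := EBrefl _ H1
  have H2' := (EBrefl _ H2).neg
  have hκ : EB 0 (fun _ : ℝ => 1 / (2 * P * m)) := (Wk.const _ 0).eb
  have hne : 2 * P * m ≠ 0 := by positivity
  refine ⟨fun s => 1 / (2 * P * m) * (y P s * G s + y (-P) s * H (-s)),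
    fun s => 1 / (2 * P * m) * (z P s * G s + z (-P) s * H (-s)), ?_, ?_, ?_, ?_⟩
  · have := hκ.mul (G1.add H1')
    simpa only [zero_add, refl] using this
  · have := hκ.mul (G2.add H2')
    simpa only [zero_add, reflz, neg_mul, neg_neg] using this
  · intro s
    have := (((hy' P s).mul (hG s)).add ((hy' (-P) s).mul (hH' s))).const_mul (1 / (2 * P * m))
    refine this.congr_deriv ?_
    ring
  · intro s
    have := (((hz' P s).mul (hG s)).add ((hz' (-P) s).mul (hH' s))).const_mul (1 / (2 * P * m))
    refine this.congr_deriv ?_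
    have hw := wronskian (ψ := ψ) d P (-P) s
    rw [← hy, ← hz] at hw
    field_simp
    linear_combination (-f s) * hw

lemma mkData (m : ℝ) (hm : 2 ≤ m) : Data m (fun s => sinh (m * s) / cosh (m * s))
    (fun s => cosh (m * s) ^ (-((m - 1) / m))) (fun s => cosh (m * s) ^ ((m - 1) / m)) := by
  have m0 : m ≠ 0 := by linarith
  have hc : ∀ s, HasDerivAt (fun s => cosh (m * s)) (m * sinh (m * s)) s := fun s => by
    have := ((hasDerivAt_id s).const_mul m).cosh
    refine this.congr_deriv ?_
    simp; ring
  have hs : ∀ s, HasDerivAt (fun s => sinh (m * s)) (m * cosh (m * s)) s := fun s => by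
    have := ((hasDerivAt_id s).const_mul m).sinh
    refine this.congr_deriv ?_
    simp; ring
  have hpow : ∀ e s, HasDerivAt (fun s => cosh (m * s) ^ e)
      (m * e * (sinh (m * s) / cosh (m * s)) * cosh (m * s) ^ e) s := fun e s => by
    have c0 := cosh_pos (m * s)
    have := (hc s).rpow_const (p := e) (Or.inl c0.ne')
    refine this.congr_deriv ?_
    rw [rpow_sub_one c0.ne']
    field_simp
  have up : ∀ s, cosh (m * s) ^ ((m - 1) / m) ≤ exp ((m - 1) * |s|) := fun s => by
    calc _ ≤ (exp |m * s|) ^ ((m - 1) / m) :=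
          rpow_le_rpow (cosh_pos _).le (cosh_upper _) (by apply div_nonneg <;> linarith)
      _ = _ := by
        rw [← exp_mul, abs_mul, abs_of_pos (by linarith : 0 < m)]
        congr 1
        field_simp
  refine ⟨hm, ?_, ?_, ?_, ?_, ?_, ?_, ?_, ?_, ?_, ?_, up, ?_⟩
  · intro s
    have := (hs s).div (hc s) (cosh_pos _).ne'
    refine this.congr_deriv ?_
    have c0 := cosh_pos (m * s)
    field_simp
  · intro s
    refine (hpow _ s).congr_deriv ?_
    field_simp
  · intro s
    refine (hpow _ s).congr_deriv ?_
    field_simp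
  · intro s
    have c0 := cosh_pos (m * s)
    rw [abs_div, abs_of_pos c0, div_le_one c0, ← sq_le_sq₀ (abs_nonneg _) c0.le, sq_abs, cosh_sq]
    linarith
  · intro s
    simp [neg_div]
  · intro s
    simp
  · intro s
    simp
  · intro s
    exact rpow_pos_of_pos (cosh_pos _) _
  · intro s
    rw [← rpow_add (cosh_pos _)]; simp
  · intro s
    have h1 : 0 ≤ (m - 1) / m := by apply div_nonneg <;> linarith
    have h2 : (m - 1) / m ≤ 1 := by rw [div_le_one] <;> linarith
    calc cosh (m * s) ^ (-((m - 1) / m)) ≤ (exp |m * s| / 2) ^ (-((m - 1) / m)) :=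
          rpow_le_rpow_of_nonpos (by positivity) (cosh_lower _) (by linarith)
      _ = 2 ^ ((m - 1) / m) * exp (-(m - 1) * |s|) := by
          rw [div_rpow (exp_pos _).le (by norm_num), ← exp_mul, abs_mul,
            abs_of_pos (by linarith : 0 < m), rpow_neg (by norm_num : (0 : ℝ) ≤ 2), div_inv_eq_mul,
            mul_comm]
          congr 2
          field_simp
      _ ≤ _ := by
          gcongr
          exact rpow_le_self_of_one_le (by norm_num) h2
  · have h1 : Tendsto (fun s : ℝ => exp (-(2 * m) * s)) atTop (𝓝 0) :=
      tendsto_exp_atBot.comp (tendsto_id.const_mul_atTop_of_neg (by linarith))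
    have h2 := (h1.const_sub 1).div (h1.const_add 1) (by norm_num)
    simp only [sub_zero, add_zero, div_one] at h2
    refine h2.congr fun s => ?_
    simp only [Pi.div_apply]
    have c0 := cosh_pos (m * s)
    have e : exp (-(2 * m) * s) = exp (-(m * s)) * exp (-(m * s)) := by
      rw [← exp_add]; congr 1; ring
    have e' : exp (m * s) * exp (-(m * s)) = 1 := by rw [← exp_add]; simp
    rw [div_eq_div_iff (by positivity) c0.ne', e, cosh_eq, sinh_eq]
    linear_combination (-exp (-(m * s))) * e'

lemma T0_eq (n : ℕ) (hn : 3 ≤ n) (S : ℝ → ℝ) (s : ℝ) :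
    T0 n S s = deriv (deriv S) s
      + ((n : ℝ) - 1 - 1) * (sinh (((n : ℝ) - 1) * s) / cosh (((n : ℝ) - 1) * s)) * deriv S s
      + ((n : ℝ) - 1) * ((n : ℝ) - 1 + 1) *
        (1 - (sinh (((n : ℝ) - 1) * s) / cosh (((n : ℝ) - 1) * s)) ^ 2) * S s := by
  have hm : (3 : ℝ) ≤ n := by exact_mod_cast hn
  have m0 : (n : ℝ) - 1 ≠ 0 := by linarith
  have c0 := cosh_pos (((n : ℝ) - 1) * s)
  have h1 : deriv (catProfile n) s / catProfile n s
      = sinh (((n : ℝ) - 1) * s) / cosh (((n : ℝ) - 1) * s) := by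
    rw [div_eq_iff (catProfile_pos n s).ne']
    refine HasDerivAt.deriv ?_
    have := (((hasDerivAt_id s).const_mul ((n : ℝ) - 1)).cosh).rpow_const
      (p := 1 / ((n : ℝ) - 1)) (Or.inl c0.ne')
    refine this.congr_deriv ?_
    simp only [id, mul_one]
    rw [rpow_sub_one c0.ne', catProfile]
    field_simp
  have h2 : catProfile n s ^ (2 - 2 * (n : ℝ))
      = 1 - (sinh (((n : ℝ) - 1) * s) / cosh (((n : ℝ) - 1) * s)) ^ 2 := by
    unfold catProfile
    rw [← rpow_mul c0.le, show 1 / ((n : ℝ) - 1) * (2 - 2 * n) = -(2 : ℕ) by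
      field_simp; push_cast; ring, rpow_neg c0.le, rpow_natCast]
    field_simp
    rw [cosh_sq]; ring
  unfold T0
  rw [h1, h2]
  ring

theorem T0_isomorphism (n k : ℕ) (hn : 3 ≤ n) (hk : 2 ≤ k) (q : ℝ)
    (hq : q ∈ Set.Ioo (-((n : ℝ) - 2)) 0) :
    ∀ f : ℝ → ℝ, InWeightedCk n (k - 2) q f →
      ∃! S : ℝ → ℝ, InWeightedCk n k q S ∧ ∀ s : ℝ, T0 n S s = f s := by
  intro f hf
  obtain ⟨j, rfl⟩ := Nat.exists_eq_add_of_le' hk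
  obtain ⟨hq1, hq2⟩ := hq
  have hn' : (3 : ℝ) ≤ n := by exact_mod_cast hn
  rw [Nat.add_sub_cancel, weighted_iff n hn hq2.le] at hf
  have d := mkData ((n : ℝ) - 1) (by linarith)
  have hU := Wk.of_deriv_eq d.hu d.u1 j
  obtain ⟨S, T, hS, hT, dS, dT⟩ := exist d hq2 (by linarith) hf.cont hf.eb
  have eT : deriv S = T := funext fun s => (dS s).deriv
  refine ⟨S, ⟨?_, ?_⟩, ?_⟩
  · rw [weighted_iff n hn hq2.le]
    refine Wk.bootstrap hf (a := fun s => -(((n : ℝ) - 1 - 1) * (sinh (((n : ℝ) - 1) * s) / cosh (((n : ℝ) - 1) * s))))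
      (b := fun s => -(((n : ℝ) - 1) * ((n : ℝ) - 1 + 1) *
        (1 - (sinh (((n : ℝ) - 1) * s) / cosh (((n : ℝ) - 1) * s)) ^ 2))) ?_ ?_ hS (eT ▸ hT)
      (fun s => (dS s).differentiableAt) (eT ▸ fun s => (dT s).differentiableAt) ?_
    · have := (Wk.const (-((n : ℝ) - 1 - 1)) j).mul0 hU
      simpa only [neg_mul] using this
    · have := (Wk.const (-(((n : ℝ) - 1) * ((n : ℝ) - 1 + 1))) j).mul0
        ((Wk.const 1 j).add ((Wk.const (-1) j).mul0 (hU.mul0 hU)))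
      convert this using 2
      ring
    · intro s
      rw [eT]
      exact (dT s).deriv
  · intro s
    rw [T0_eq n hn, eT, (dT s).deriv]
    ring
  · rintro R ⟨hR, hRf⟩
    rw [weighted_iff n hn hq2.le] at hR
    have dR : ∀ s, HasDerivAt R (deriv R s) s := fun s => (hR.2.1 s).hasDerivAt
    have dR' : ∀ s, HasDerivAt (deriv R) (deriv (deriv R) s) s := fun s =>
      (hR.2.2.2.1 s).hasDerivAt
    have := uniq d hq2 (S := fun s => R s + - S s) (T := fun s => deriv R s + - T s)
      (hR.1.add hS.neg) (fun s => (dR s).add (dS s).neg) (fun s => by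
        refine ((dR' s).add (dT s).neg).congr_deriv ?_
        have h := hRf s
        rw [T0_eq n hn] at h
        linear_combination h)
    funext s
    have h := this s
    linarith
end
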